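/- arXiv:1303.0969 — 2 statements merged into one kernel-verified Lean document; each statement's English description precedes it below -/
import Mathlib

section
/- Let α, ρ ∈ (0,1) with α irrational. If 0 < ρ ≤ min{α, 1−α}, then R'^α_ρ = {0, 1, 10}, where 0, 1, 10 denote the binary words of lengths 1, 1, 2 respectively. -/
open Set

noncomputable section

/-- Exchange of two intervals with parameter `α`, acting on `[0,1)`:
`T_α(x) = x + 1 - α` for `x ∈ [0,α)` and `T_α(x) = x - α` for `x ∈ [α,1)`. -/
def twoIE (α x : ℝ) : ℝ := if x < α then x + 1 - α else x - α

/-- The Sturmian word with slope `α` and intercept `ρ`: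
`false` codes the letter 0 (i.e. `T_α^n(ρ) ∈ [0,α)`), `true` codes the letter 1. -/
def sturmian (α ρ : ℝ) (n : ℕ) : Bool := if α ≤ (twoIE α)^[n] ρ then true else false

/-- The factor of length `n` of an infinite word `u` starting at position `i`. -/
def seg (u : ℕ → Bool) (i n : ℕ) : List Bool := (List.range n).map (fun j => u (i + j))

/-- The prefix of length `n` of `u`. -/
def wordPrefix (u : ℕ → Bool) (n : ℕ) : List Bool := seg u 0 n

/-- Return time of `x` to the set `I` under `twoIE α`:
the least `m ≥ 1` such that `T_α^m(x) ∈ I`. -/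
def returnTime (α : ℝ) (I : Set ℝ) (x : ℝ) : ℕ :=
  sInf {m : ℕ | 0 < m ∧ (twoIE α)^[m] x ∈ I}

/-- The `I`-itinerary of `x`: the prefix of length `returnTime α I x` of the
Sturmian word with slope `α` and intercept `x`. -/
def itin (α : ℝ) (I : Set ℝ) (x : ℝ) : List Bool :=
  wordPrefix (sturmian α x) (returnTime α I x)

/-- Two binary words are abelian equivalent if they have the same length and the
same number of occurrences of the letter 0 (coded by `false`). -/
def AbEquiv (w w' : List Bool) : Prop :=
  w.length = w'.length ∧ w.count false = w'.count false

/-- `w` is a factor of the infinite word `u`. -/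
def IsFactor (u : ℕ → Bool) (w : List Bool) : Prop := ∃ i, seg u i w.length = w

/-- Positions of occurrences in `u` of factors abelian equivalent to `w`. -/
def abOcc (u : ℕ → Bool) (w : List Bool) : Set ℕ :=
  {i | AbEquiv (seg u i w.length) w}

/-- The set of abelian return words to `w` in `u`: the words of `u` lying between
two consecutive occurrences of factors abelian equivalent to `w`. -/
def AR (u : ℕ → Bool) (w : List Bool) : Set (List Bool) :=
  {v | ∃ i j : ℕ, i ∈ abOcc u w ∧ j ∈ abOcc u w ∧ i < j ∧
        (∀ m, i < m → m < j → m ∉ abOcc u w) ∧ v = seg u i (j - i)}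

/-- The set of abelian return words to all nonempty prefixes of `u`. -/
def APR (u : ℕ → Bool) : Set (List Bool) :=
  ⋃ n ∈ {n : ℕ | 1 ≤ n}, AR u (wordPrefix u n)

/-- `S_β`: the set of `[0,β)`-itineraries under `twoIE α`. -/
def Sitin (α β : ℝ) : Set (List Bool) :=
  {w | ∃ x ∈ Ico (0:ℝ) β, itin α (Ico (0:ℝ) β) x = w}

/-- `R^α_ρ`: the union of the sets of `[0,β)`-itineraries over `ρ ≤ β < 1`. -/
def Rlight (α ρ : ℝ) : Set (List Bool) := ⋃ β ∈ Ico ρ 1, Sitin α β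

/-- `R'^α_ρ`: the union of the sets of `[γ,1)`-itineraries over `0 < γ ≤ ρ`. -/
def Rheavy (α ρ : ℝ) : Set (List Bool) :=
  ⋃ γ ∈ Ioc (0:ℝ) ρ, {w | ∃ x ∈ Ico γ 1, itin α (Ico γ 1) x = w}

/-- The Gauss map `x ↦ {1/x}`. -/
def gaussMap (x : ℝ) : ℝ := Int.fract x⁻¹

/-- The `k`-th partial quotient `a_k` (for `k ≥ 1`) of the continued fraction
expansion `α = [0; a_1, a_2, …]` of `α ∈ (0,1)`. -/
def cfa (α : ℝ) (k : ℕ) : ℕ := ⌊(gaussMap^[k - 1] α)⁻¹⌋₊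

/-- `cfPQ α n = (p_{n-1}, q_{n-1})`, numerators and denominators of the convergents
of `α`: `p_{-1} = 1`, `q_{-1} = 0`, `p_0 = 0`, `q_0 = 1`,
`p_k = a_k p_{k-1} + p_{k-2}`, `q_k = a_k q_{k-1} + q_{k-2}`. -/
def cfPQ (α : ℝ) : ℕ → ℤ × ℤ
  | 0 => (1, 0)
  | 1 => (0, 1)
  | (k + 2) => ((cfa α (k + 1) : ℤ) * (cfPQ α (k + 1)).1 + (cfPQ α k).1,
                (cfa α (k + 1) : ℤ) * (cfPQ α (k + 1)).2 + (cfPQ α k).2)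

/-- `δ_{k,s} = |(s-1)(p_k - α q_k) + p_{k-1} - α q_{k-1}|` for `k ≥ 0`, `1 ≤ s ≤ a_{k+1}`. -/
def cfDelta (α : ℝ) (k s : ℕ) : ℝ :=
  |((s : ℝ) - 1) * (((cfPQ α (k + 1)).1 : ℝ) - α * ((cfPQ α (k + 1)).2 : ℝ)) +
      (((cfPQ α k).1 : ℝ) - α * ((cfPQ α k).2 : ℝ))|

end

theorem returnTime_eq_one {α : ℝ} {I : Set ℝ} {x : ℝ} (h : twoIE α x ∈ I) :
    returnTime α I x = 1 := by
  have hmem : 1 ∈ {m : ℕ | 0 < m ∧ (twoIE α)^[m] x ∈ I} := ⟨one_pos, by simpa using h⟩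
  exact le_antisymm (Nat.sInf_le hmem) (Nat.sInf_mem ⟨1, hmem⟩).1

theorem returnTime_eq_two {α : ℝ} {I : Set ℝ} {x : ℝ} (h₁ : twoIE α x ∉ I)
    (h₂ : twoIE α (twoIE α x) ∈ I) : returnTime α I x = 2 := by
  have hmem : 2 ∈ {m : ℕ | 0 < m ∧ (twoIE α)^[m] x ∈ I} := ⟨two_pos, by simpa using h₂⟩
  refine le_antisymm (Nat.sInf_le hmem) ?_
  obtain ⟨hpos, hI⟩ := Nat.sInf_mem ⟨2, hmem⟩
  refine Nat.succ_le_of_lt (lt_of_le_of_ne hpos fun hone => ?_)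
  rw [← show 1 = sInf _ from hone] at hI
  exact h₁ (by simpa using hI)

theorem itin_Ico_of_lt {α γ x : ℝ} (hα : α < 1) (hx : x ∈ Set.Ico γ 1) (hxα : x < α) :
    itin α (Set.Ico γ 1) x = [false] := by
  have hT : twoIE α x = x + 1 - α := if_pos hxα
  have hret : returnTime α (Set.Ico γ 1) x = 1 :=
    returnTime_eq_one (by rw [hT]; constructor <;> linarith [hx.1])
  simp [itin, hret, wordPrefix, seg, sturmian, hxα.not_ge]

theorem itin_Ico_of_add_le {α γ x : ℝ} (hα : 0 < α) (hγ : 0 ≤ γ) (hx : x < 1)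
    (hxα : α + γ ≤ x) : itin α (Set.Ico γ 1) x = [true] := by
  have hle : α ≤ x := by linarith
  have hT : twoIE α x = x - α := if_neg hle.not_gt
  have hret : returnTime α (Set.Ico γ 1) x = 1 :=
    returnTime_eq_one (by rw [hT]; constructor <;> linarith)
  simp [itin, hret, wordPrefix, seg, sturmian, hle]

theorem itin_Ico_of_lt_add {α γ x : ℝ} (hγα : γ ≤ α) (hγα' : γ ≤ 1 - α) (hxα : α ≤ x)
    (hxγ : x < α + γ) : itin α (Set.Ico γ 1) x = [true, false] := by
  have hT : twoIE α x = x - α := if_neg hxα.not_gt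
  have hlt : x - α < α := by linarith
  have hT' : twoIE α (x - α) = x - α + 1 - α := if_pos hlt
  have hret : returnTime α (Set.Ico γ 1) x = 2 := by
    refine returnTime_eq_two ?_ ?_
    · rw [hT]
      exact fun hmem => by linarith [hmem.1]
    · rw [hT, hT']
      constructor <;> linarith
  simp [itin, hret, wordPrefix, seg, sturmian, hxα, hT, hlt, List.range_succ]

/-- if `0 < ρ ≤ min{α,1-α}` then `R'^α_ρ = {0, 1, 10}`. -/
theorem Rheavy_eq_of_small_intercept (α ρ : ℝ) (hα : α ∈ Set.Ioo (0:ℝ) 1)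
    (hirr : Irrational α) (hρ : ρ ∈ Set.Ioo (0:ℝ) 1)
    (h : ρ ≤ min α (1 - α)) :
    Rheavy α ρ = ({[false], [true], [true, false]} : Set (List Bool)) := by
  obtain ⟨hα₀, hα₁⟩ := hα
  obtain ⟨hρ₀, -⟩ := hρ
  obtain ⟨hρα, hρα'⟩ := le_min_iff.mp h
  ext w
  simp only [Rheavy, Set.mem_iUnion, Set.mem_ofPred_eq, Set.mem_insert_iff,
    Set.mem_singleton_iff, exists_prop]
  constructor
  · rintro ⟨γ, ⟨hγ₀, hγρ⟩, x, hx, rfl⟩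
    rcases lt_or_ge x α with hxα | hxα
    · exact Or.inl (itin_Ico_of_lt hα₁ hx hxα)
    · rcases lt_or_ge x (α + γ) with hxγ | hxγ
      · exact Or.inr (Or.inr (itin_Ico_of_lt_add (by linarith) (by linarith) hxα hxγ))
      · exact Or.inr (Or.inl (itin_Ico_of_add_le hα₀ hγ₀.le hx.2 hxγ))
  · intro hw
    refine ⟨ρ / 2, ⟨by linarith, by linarith⟩, ?_⟩
    rcases hw with rfl | rfl | rfl
    · have hmem : ρ / 2 ∈ Set.Ico (ρ / 2) 1 := ⟨le_rfl, by linarith⟩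
      exact ⟨ρ / 2, hmem, itin_Ico_of_lt hα₁ hmem (by linarith)⟩
    · exact ⟨α + ρ / 2, ⟨by linarith, by linarith⟩,
        itin_Ico_of_add_le hα₀ (by linarith) (by linarith) le_rfl⟩
    · exact ⟨α, ⟨by linarith, hα₁⟩,
        itin_Ico_of_lt_add (by linarith) (by linarith) le_rfl (by linarith)⟩
end

section
/- Let α, ρ ∈ (0,1) with α irrational and let u = u_{α,ρ}. Then {0, 1, 01, 10} ⊆ APR_u, where 0, 1 are the one-letter binary words and 01, 10 the two-letter binary words. -/
open Set

/-- The forward orbit of any point under an irrational rotation of the circle is dense. -/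
theorem exists_nat_fract_mem_Ioo {θ : ℝ} (hθ : Irrational θ) (c : ℝ) {a b : ℝ}
    (ha : 0 ≤ a) (hab : a < b) (hb : b ≤ 1) :
    ∃ n : ℕ, Int.fract (c + n * θ) ∈ Ioo a b := by
  have : Fact ((0 : ℝ) < 1) := ⟨one_pos⟩
  have hd : DenseRange (fun n : ℕ => n • (θ : AddCircle (1 : ℝ))) :=
    denseRange_zsmul_iff_nsmul.mp (AddCircle.denseRange_zsmul_coe_iff.mpr (by simpa using hθ))
  have hU : IsOpen ((fun y : ℝ => (y : AddCircle (1 : ℝ))) '' Ioo (a - c) (b - c)) :=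
    QuotientAddGroup.isOpenMap_coe _ isOpen_Ioo
  obtain ⟨n, y, hy, hyn⟩ := hd.exists_mem_open hU ((nonempty_Ioo.mpr (by linarith)).image _)
  have h0 : ((n * θ - y : ℝ) : AddCircle (1 : ℝ)) = 0 := by
    rw [AddCircle.coe_sub, sub_eq_zero, ← nsmul_eq_mul]
    exact hyn.symm
  obtain ⟨z, hz⟩ := AddCircle.coe_eq_zero_iff (1 : ℝ) |>.mp h0
  have hfr : Int.fract (c + n * θ) = c + y := by
    refine Int.fract_eq_iff.mpr ⟨by linarith [hy.1], by linarith [hy.2], z, ?_⟩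
    simp only [zsmul_eq_mul, mul_one] at hz
    linarith
  exact ⟨n, by rw [hfr]; constructor <;> linarith [hy.1, hy.2]⟩

theorem twoIE_eq_fract {α x : ℝ} (hα : α ∈ Ioo (0 : ℝ) 1) (hx : x ∈ Ico (0 : ℝ) 1) :
    twoIE α x = Int.fract (x - α) := by
  obtain ⟨hα0, hα1⟩ := hα
  obtain ⟨hx0, hx1⟩ := hx
  symm
  rw [Int.fract_eq_iff, twoIE]
  split_ifs with h
  · exact ⟨by linarith, by linarith, -1, by push_cast; ring⟩
  · exact ⟨by linarith, by linarith, 0, by simp⟩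

/-- `T_α` is the rotation by `-α`, so its `n`-th iterate is the rotation by `-nα`. -/
theorem iterate_twoIE {α x : ℝ} (hα : α ∈ Ioo (0 : ℝ) 1) (hx : x ∈ Ico (0 : ℝ) 1) (n : ℕ) :
    (twoIE α)^[n] x = Int.fract (x - n * α) := by
  induction n with
  | zero => simpa using (Int.fract_eq_self.mpr hx).symm
  | succ n ih =>
    rw [Function.iterate_succ_apply', ih,
      twoIE_eq_fract hα ⟨Int.fract_nonneg _, Int.fract_lt_one _⟩, Int.fract_eq_fract]
    refine ⟨-⌊x - n * α⌋, ?_⟩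
    rw [Int.fract]
    push_cast
    ring

theorem iterate_twoIE_mem {α x : ℝ} (hα : α ∈ Ioo (0 : ℝ) 1) (hx : x ∈ Ico (0 : ℝ) 1) (n : ℕ) :
    (twoIE α)^[n] x ∈ Ico (0 : ℝ) 1 := by
  rw [iterate_twoIE hα hx]
  exact ⟨Int.fract_nonneg _, Int.fract_lt_one _⟩

/-- Rotating by `-nα` wraps around exactly at the points below `{nα}`. -/
theorem iterate_twoIE_eq_ite {α x : ℝ} (hα : α ∈ Ioo (0 : ℝ) 1) (hx : x ∈ Ico (0 : ℝ) 1) (n : ℕ) :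
    (twoIE α)^[n] x =
      x - Int.fract (n * α) + if x < Int.fract (n * α) then 1 else 0 := by
  have h0 := Int.fract_nonneg ((n : ℝ) * α)
  have h1 := Int.fract_lt_one ((n : ℝ) * α)
  have h2 := Int.self_sub_fract ((n : ℝ) * α)
  obtain ⟨hx0, hx1⟩ := hx
  rw [iterate_twoIE hα ⟨hx0, hx1⟩, Int.fract_eq_iff]
  split_ifs with h
  · exact ⟨by linarith, by linarith, -⌊(n : ℝ) * α⌋ - 1, by push_cast; linarith⟩
  · exact ⟨by linarith, by linarith, -⌊(n : ℝ) * α⌋, by push_cast; linarith⟩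

theorem seg_succ (u : ℕ → Bool) (i n : ℕ) : seg u i (n + 1) = seg u i n ++ [u (i + n)] := by
  simp [seg, List.range_succ]

@[simp]
theorem length_seg (u : ℕ → Bool) (i n : ℕ) : (seg u i n).length = n := by
  simp [seg]

theorem count_seg_sturmian (α ρ : ℝ) (i n : ℕ) :
    ((seg (sturmian α ρ) i n).count false : ℝ) =
      (twoIE α)^[i + n] ρ - (twoIE α)^[i] ρ + n * α := by
  induction n with
  | zero => simp [seg]
  | succ n ih =>
    rw [seg_succ, List.count_append, Nat.cast_add, ih, ← add_assoc, Function.iterate_succ_apply',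
      sturmian, twoIE]
    by_cases h : α ≤ (twoIE α)^[i + n] ρ
    · simp [h, not_lt.mpr h]; ring
    · simp [h, not_le.mp h]; ring

/-- The abelian class of the length-`n` factor at position `i` is determined by the side of `{nα}`
on which the `i`-th point of the orbit lies. -/
theorem mem_abOcc_wordPrefix_iff {α ρ : ℝ} (hα : α ∈ Ioo (0 : ℝ) 1) (hρ : ρ ∈ Ico (0 : ℝ) 1)
    (n i : ℕ) :
    i ∈ abOcc (sturmian α ρ) (wordPrefix (sturmian α ρ) n) ↔
      ((twoIE α)^[i] ρ < Int.fract (n * α) ↔ ρ < Int.fract (n * α)) := by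
  have hi := count_seg_sturmian α ρ i n
  have h0 := count_seg_sturmian α ρ 0 n
  rw [add_comm i, Function.iterate_add_apply,
    iterate_twoIE_eq_ite hα (iterate_twoIE_mem hα hρ i)] at hi
  rw [zero_add, iterate_twoIE_eq_ite hα hρ, Function.iterate_zero_apply] at h0
  simp only [abOcc, AbEquiv, wordPrefix, mem_ofPred_eq, length_seg, true_and]
  rw [← Nat.cast_inj (R := ℝ), hi, h0]
  have hcancel (x β c : ℝ) : x - β + c - x = c - β := by ring
  simp only [hcancel, add_left_inj, sub_left_inj]
  split_ifs with h1 h2 h2 <;> simp [h1, h2]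

theorem seg_mem_APR {u : ℕ → Bool} {n i d : ℕ} (hn : n ≠ 0) (hd : 0 < d)
    (hi : i ∈ abOcc u (wordPrefix u n)) (hj : i + d ∈ abOcc u (wordPrefix u n))
    (hm : ∀ m, i < m → m < i + d → m ∉ abOcc u (wordPrefix u n)) :
    seg u i d ∈ APR u :=
  mem_biUnion (show n ∈ {n : ℕ | 1 ≤ n} from Nat.one_le_iff_ne_zero.mpr hn)
    ⟨i, i + d, hi, hj, by omega, hm, by simp⟩

theorem ne_zero_of_fract_mul_pos {α : ℝ} {n : ℕ} (h : 0 < Int.fract (n * α)) : n ≠ 0 := by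
  rintro rfl
  simp at h

/-- The orbit of any point under `T_α` is dense. -/
theorem exists_iterate_twoIE_mem_Ioo {α ρ : ℝ} (hα : α ∈ Ioo (0 : ℝ) 1) (hirr : Irrational α)
    (hρ : ρ ∈ Ico (0 : ℝ) 1) {a b : ℝ} (ha : 0 ≤ a) (hab : a < b) (hb : b ≤ 1) :
    ∃ i : ℕ, (twoIE α)^[i] ρ ∈ Ioo a b := by
  obtain ⟨i, hi⟩ := exists_nat_fract_mem_Ioo hirr.neg ρ ha hab hb
  refine ⟨i, ?_⟩
  rwa [iterate_twoIE hα hρ, sub_eq_add_neg, ← mul_neg]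

/-- A point and its image on the same side of `{nα}` as `ρ` give a one-letter return word. -/
theorem singleton_mem_APR {α ρ : ℝ} (hα : α ∈ Ioo (0 : ℝ) 1) (hρ : ρ ∈ Ico (0 : ℝ) 1)
    {n i : ℕ} (hn : n ≠ 0)
    (h₀ : (twoIE α)^[i] ρ < Int.fract (n * α) ↔ ρ < Int.fract (n * α))
    (h₁ : twoIE α ((twoIE α)^[i] ρ) < Int.fract (n * α) ↔ ρ < Int.fract (n * α)) :
    [sturmian α ρ i] ∈ APR (sturmian α ρ) := by
  rw [← Function.iterate_succ_apply' (twoIE α)] at h₁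
  have h := seg_mem_APR hn one_pos ((mem_abOcc_wordPrefix_iff hα hρ n i).mpr h₀)
    ((mem_abOcc_wordPrefix_iff hα hρ n (i + 1)).mpr h₁) (by omega)
  simpa [seg] using h

/-- A point that leaves the side of `{nα}` containing `ρ` for exactly one step gives a two-letter
return word. -/
theorem pair_mem_APR {α ρ : ℝ} (hα : α ∈ Ioo (0 : ℝ) 1) (hρ : ρ ∈ Ico (0 : ℝ) 1)
    {n i : ℕ} (hn : n ≠ 0)
    (h₀ : (twoIE α)^[i] ρ < Int.fract (n * α) ↔ ρ < Int.fract (n * α))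
    (h₁ : ¬(twoIE α ((twoIE α)^[i] ρ) < Int.fract (n * α) ↔ ρ < Int.fract (n * α)))
    (h₂ : twoIE α (twoIE α ((twoIE α)^[i] ρ)) < Int.fract (n * α) ↔ ρ < Int.fract (n * α)) :
    [sturmian α ρ i, sturmian α ρ (i + 1)] ∈ APR (sturmian α ρ) := by
  rw [← Function.iterate_succ_apply' (twoIE α)] at h₁ h₂
  rw [← Function.iterate_succ_apply' (twoIE α)] at h₂
  have h := seg_mem_APR hn two_pos ((mem_abOcc_wordPrefix_iff hα hρ n i).mpr h₀)
    ((mem_abOcc_wordPrefix_iff hα hρ n (i + 2)).mpr h₂) (fun m hm hm' => by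
      obtain rfl : m = i + 1 := by omega
      exact (mem_abOcc_wordPrefix_iff hα hρ n (i + 1)).not.mpr h₁)
  exact h

theorem twoIE_of_lt {α x : ℝ} (h : x < α) : twoIE α x = x + 1 - α := if_pos h

theorem twoIE_of_le {α x : ℝ} (h : α ≤ x) : twoIE α x = x - α := if_neg h.not_gt

theorem sturmian_eq_false {α ρ : ℝ} {i : ℕ} (h : (twoIE α)^[i] ρ < α) :
    sturmian α ρ i = false := if_neg h.not_ge

theorem sturmian_eq_true {α ρ : ℝ} {i : ℕ} (h : α ≤ (twoIE α)^[i] ρ) :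
    sturmian α ρ i = true := if_pos h

/-- `{0, 1, 01, 10} ⊆ APR_u` for every Sturmian word `u = u_{α,ρ}`
with `α, ρ ∈ (0,1)`, `α` irrational. -/
theorem four_words_mem_APR (α ρ : ℝ) (hα : α ∈ Set.Ioo (0:ℝ) 1)
    (hirr : Irrational α) (hρ : ρ ∈ Set.Ioo (0:ℝ) 1) :
    ({[false], [true], [false, true], [true, false]} : Set (List Bool)) ⊆
      APR (sturmian α ρ) := by
  have hρ' : ρ ∈ Ico (0 : ℝ) 1 := Ioo_subset_Ico_self hρ
  have ⟨hα0, hα1⟩ := hα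
  have ⟨hρ0, hρ1⟩ := hρ
  obtain ⟨n, hn, hn1⟩ := exists_nat_fract_mem_Ioo hirr 0 (a := max ρ (max α (1 - α))) (b := 1)
    (by simp [hρ0.le]) (by simp [hρ1, hα0, hα1]) le_rfl
  obtain ⟨k, hk0, hk⟩ := exists_nat_fract_mem_Ioo hirr 0 (a := 0) (b := min ρ (min α (1 - α)))
    le_rfl (by simp [hρ0, hα0, hα1]) (by simp [hρ1.le])
  simp only [zero_add, max_lt_iff, lt_min_iff] at hn hn1 hk0 hk
  obtain ⟨hnρ, hnα, hnα'⟩ := hn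
  obtain ⟨hkρ, hkα, hkα'⟩ := hk
  have hn0 : n ≠ 0 := ne_zero_of_fract_mul_pos (hρ0.trans hnρ)
  have hk0' : k ≠ 0 := ne_zero_of_fract_mul_pos hk0
  rintro w (rfl | rfl | rfl | rfl)
  · obtain ⟨i, hi0, hi⟩ := exists_iterate_twoIE_mem_Ioo hα hirr hρ' (a := 0)
      (b := Int.fract (n * α) - (1 - α)) le_rfl (by linarith) (by linarith)
    have hiα : (twoIE α)^[i] ρ < α := by linarith
    have h := singleton_mem_APR (i := i) hα hρ' hn0
      (iff_of_true (by linarith) hnρ)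
      (iff_of_true (by rw [twoIE_of_lt hiα]; linarith) hnρ)
    rwa [sturmian_eq_false hiα] at h
  · obtain ⟨i, hi0, hi⟩ := exists_iterate_twoIE_mem_Ioo hα hirr hρ' hα0.le hnα hn1.le
    have h := singleton_mem_APR (i := i) hα hρ' hn0
      (iff_of_true hi hnρ)
      (iff_of_true (by rw [twoIE_of_le hi0.le]; linarith) hnρ)
    rwa [sturmian_eq_true hi0.le] at h
  · obtain ⟨i, hi0, hi⟩ := exists_iterate_twoIE_mem_Ioo hα hirr hρ'
      (a := Int.fract (n * α) - (1 - α)) (b := α) (by linarith) (by linarith) hα1.le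
    have hT : twoIE α ((twoIE α)^[i] ρ) = (twoIE α)^[i] ρ + 1 - α := twoIE_of_lt hi
    have hTα : α ≤ twoIE α ((twoIE α)^[i] ρ) := by linarith
    have h := pair_mem_APR (i := i) hα hρ' hn0
      (iff_of_true (by linarith) hnρ)
      (fun h => (h.mpr hnρ).not_ge (by linarith))
      (iff_of_true (by rw [twoIE_of_le hTα]; linarith) hnρ)
    rw [← Function.iterate_succ_apply' (twoIE α)] at hTα
    rwa [sturmian_eq_false hi, sturmian_eq_true hTα] at h
  · obtain ⟨i, hi0, hi⟩ := exists_iterate_twoIE_mem_Ioo hα hirr hρ'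
      (a := α) (b := min 1 (α + Int.fract (k * α))) hα0.le (by simp [hα1, hk0]) (min_le_left _ _)
    have hi' := (lt_min_iff.mp hi).2
    have hT : twoIE α ((twoIE α)^[i] ρ) = (twoIE α)^[i] ρ - α := twoIE_of_le hi0.le
    have hTα : twoIE α ((twoIE α)^[i] ρ) < α := by linarith
    have h := pair_mem_APR (i := i) hα hρ' hk0'
      (iff_of_false (by linarith) hkρ.not_gt)
      (fun h => hkρ.not_gt (h.mp (by linarith)))
      (iff_of_false (by rw [twoIE_of_lt hTα]; linarith) hkρ.not_gt)
    rw [← Function.iterate_succ_apply' (twoIE α)] at hTα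
    rwa [sturmian_eq_true hi0.le, sturmian_eq_false hTα] at h
end
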